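/- In the setting of the decreasing recursion φ_n for the CVR conjectures (with D̂S_{T−1} nonempty-valued), for every k ∈ A_1∪B_1 and every n the set φ_n(∅,k) contains every matching m̄ ∈ M_T(∅,k) in which no agent matches in period 1 and whose continuation (m̄_t)_{t=2}^T lies in D̂S_{T−1}(E_2^T(m̄_1)); consequently the limit φ_∞(∅,k) = φ_{D̂S,1}(∅,k) is nonempty for every k ∈ A_1∪B_1. -/

import Mathlib

/-!
A framework for two-sided, one-to-one, irreversible dynamic matching markets
with conjectures, following Doval's "A framework for (dynamic) stability".

Periods are indexed `0, …, T-1` (the paper's periods `1, …, T`).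
-/

namespace DynMatch

open Classical

noncomputable section

/-- A length-`T` two-sided dynamic economy: the arrivals on each side in each period. -/
structure Economy (A B : Type) where
  T : ℕ
  arrA : ℕ → Finset A
  arrB : ℕ → Finset B

/-- Validity of an economy: positive length, pairwise disjoint arrivals, and
no arrivals outside the horizon. -/
def Economy.Valid {A B : Type} (E : Economy A B) : Prop :=
  0 < E.T ∧
  (∀ s t, s ≠ t → Disjoint (E.arrA s) (E.arrA t)) ∧
  (∀ s t, s ≠ t → Disjoint (E.arrB s) (E.arrB t)) ∧
  (∀ s, E.T ≤ s → E.arrA s = ∅) ∧ (∀ s, E.T ≤ s → E.arrB s = ∅)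

/-- A raw dynamic matching: in every period, a partial pairing between the two sides
(`none` means unmatched, i.e. matched to oneself). -/
structure PreMatching (A B : Type) where
  mA : ℕ → A → Option B
  mB : ℕ → B → Option A

variable {A B : Type} [DecidableEq A] [DecidableEq B]

/-- Side-`A` agents having arrived up to (and including) period `t`. -/
def arrAUpTo (E : Economy A B) (t : ℕ) : Finset A := (Finset.range (t+1)).biUnion E.arrA

/-- Side-`B` agents having arrived up to (and including) period `t`. -/
def arrBUpTo (E : Economy A B) (t : ℕ) : Finset B := (Finset.range (t+1)).biUnion E.arrB

/-- `m` is an irreversible dynamic matching for the economy `E`: in every period it is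
an involutive pairing between arrived agents of the two sides, and once matched a
pair stays matched. -/
def IsMatching (E : Economy A B) (m : PreMatching A B) : Prop :=
  (∀ t a b, t < E.T → (m.mA t a = some b ↔ m.mB t b = some a)) ∧
  (∀ t a, t < E.T → m.mA t a ≠ none → a ∈ arrAUpTo E t) ∧
  (∀ t a b, t < E.T → m.mA t a = some b → b ∈ arrBUpTo E t) ∧
  (∀ t s a, t ≤ s → s < E.T → m.mA t a ≠ none → m.mA s a = m.mA t a) ∧
  (∀ t s b, t ≤ s → s < E.T → m.mB t b ≠ none → m.mB s b = m.mB t b)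

/-- The everywhere-unmatched prematching. -/
def emptyM : PreMatching A B := ⟨fun _ _ => none, fun _ _ => none⟩

/-- An agent of the economy: a side-`A` or a side-`B` agent. -/
abbrev Agent (A B : Type) := A ⊕ B

/-- `𝒜_t(m^{t-1})`: side-`A` agents available to match in period `t` given history `m`. -/
def availA (E : Economy A B) (m : PreMatching A B) (t : ℕ) : Finset A :=
  (arrAUpTo E t).filter fun a => ∀ s, s < t → m.mA s a = none

/-- `ℬ_t(m^{t-1})`: side-`B` agents available to match in period `t` given history `m`. -/
def availB (E : Economy A B) (m : PreMatching A B) (t : ℕ) : Finset B :=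
  (arrBUpTo E t).filter fun b => ∀ s, s < t → m.mB s b = none

/-- `k ∈ 𝒜_t(m^{t-1}) ∪ ℬ_t(m^{t-1})`. -/
def isAvail (E : Economy A B) (m : PreMatching A B) (t : ℕ) : Agent A B → Prop
  | Sum.inl a => a ∈ availA E m t
  | Sum.inr b => b ∈ availB E m t

/-- `k ∈ A_1 ∪ B_1`: `k` is a first-period arrival. -/
def inPeriodOne (E : Economy A B) : Agent A B → Prop
  | Sum.inl a => a ∈ E.arrA 0
  | Sum.inr b => b ∈ E.arrB 0

/-- `m_t(k) = k`: agent `k` is unmatched in period `t` under `m`. -/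
def unmatchedAt (m : PreMatching A B) (t : ℕ) : Agent A B → Prop
  | Sum.inl a => m.mA t a = none
  | Sum.inr b => m.mB t b = none

/-- `m` and `m'` agree in all periods `s < t` (i.e. they share the history `m^{t-1}`). -/
def agreeUpTo (m m' : PreMatching A B) (t : ℕ) : Prop :=
  ∀ s, s < t → (∀ a, m.mA s a = m'.mA s a) ∧ (∀ b, m.mB s b = m'.mB s b)

/-- Agent `k` is unmatched through period `t` (all periods `s ≤ t`) under `m`. -/
def unmatchedThrough (m : PreMatching A B) (t : ℕ) : Agent A B → Prop
  | Sum.inl a => ∀ s, s ≤ t → m.mA s a = none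
  | Sum.inr b => ∀ s, s ≤ t → m.mB s b = none

/-- `M_T(m^{t-1})`: matchings of `E` agreeing with `m` through period `t-1`. -/
def MSetH (E : Economy A B) (m : PreMatching A B) (t : ℕ) : Set (PreMatching A B) :=
  {m' | IsMatching E m' ∧ agreeUpTo m m' t}

/-- `M_T(m^{t-1}, k)`: matchings of `E` agreeing with `m` through period `t-1` and
leaving `k` unmatched through period `t`. -/
def MSet (E : Economy A B) (m : PreMatching A B) (t : ℕ) (k : Agent A B) :
    Set (PreMatching A B) :=
  {m' | IsMatching E m' ∧ agreeUpTo m m' t ∧ unmatchedThrough m' t k}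

/-- Preferences: Bernoulli utilities on both sides and discount factors.
(The payoff of remaining single is normalized to `0`.) -/
structure Pref (A B : Type) where
  u : A → B → ℝ
  v : A → B → ℝ
  dA : A → ℝ
  dB : B → ℝ

/-- Discount factors lie in `[0,1]`. -/
def Pref.Valid (P : Pref A B) : Prop :=
  (∀ a, 0 ≤ P.dA a ∧ P.dA a ≤ 1) ∧ (∀ b, 0 ≤ P.dB b ∧ P.dB b ≤ 1)

/-- `t_m(a)`: the first period `s ≥ t` at which `a` is matched under `m` (`T` if never). -/
def matchTimeA (E : Economy A B) (m : PreMatching A B) (t : ℕ) (a : A) : ℕ :=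
  min (sInf {s | t ≤ s ∧ m.mA s a ≠ none}) E.T

/-- `t_m(b)`: the first period `s ≥ t` at which `b` is matched under `m` (`T` if never). -/
def matchTimeB (E : Economy A B) (m : PreMatching A B) (t : ℕ) (b : B) : ℕ :=
  min (sInf {s | t ≤ s ∧ m.mB s b ≠ none}) E.T

/-- `U_t(a,m) = δ_a^{t_m(a)-t}·u(a, m_T(a))` (and `0` if `a` ends up unmatched). -/
def Upay (P : Pref A B) (E : Economy A B) (m : PreMatching A B) (t : ℕ) (a : A) : ℝ :=
  match m.mA (E.T - 1) a with
  | none => 0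
  | some b => P.dA a ^ (matchTimeA E m t a - t) * P.u a b

/-- `V_t(b,m) = δ_b^{t_m(b)-t}·v(m_T(b), b)` (and `0` if `b` ends up unmatched). -/
def Vpay (P : Pref A B) (E : Economy A B) (m : PreMatching A B) (t : ℕ) (b : B) : ℝ :=
  match m.mB (E.T - 1) b with
  | none => 0
  | some a => P.dB b ^ (matchTimeB E m t b - t) * P.v a b

/-- A family of conjectures `Φ`: for every period `t`, history `m^{t-1}` and agent `k`,
a set `φ_t(m^{t-1},k)` of matchings `k` considers possible upon remaining unmatched. -/
abbrev ConjFam (A B : Type) := ℕ → PreMatching A B → Agent A B → Set (PreMatching A B)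

/-- Validity of a family of conjectures for `E`: conjectures are (nonempty) subsets of
`M_T(m^{t-1},k)` and depend on the matching only through the history `m^{t-1}`. -/
def ConjFam.Valid (E : Economy A B) (φ : ConjFam A B) : Prop :=
  (∀ t m k, φ t m k ⊆ MSet E m t k) ∧
  (∀ t m m' k, agreeUpTo m m' t → φ t m k = φ t m' k) ∧
  (∀ t m k, t < E.T → IsMatching E m → isAvail E m t k → (φ t m k).Nonempty)

/-- `m` is a `Φ`-solution for `E` (Definition 3): in every period, every available agent
weakly prefers `m` to some conjectured matching, and no available pair blocks. -/
def IsSolution (P : Pref A B) (E : Economy A B) (φ : ConjFam A B)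
    (m : PreMatching A B) : Prop :=
  IsMatching E m ∧
  ∀ t, t < E.T →
    ((∀ a ∈ availA E m t, ∃ m' ∈ φ t m (Sum.inl a), Upay P E m' t a ≤ Upay P E m t a) ∧
     (∀ b ∈ availB E m t, ∃ m' ∈ φ t m (Sum.inr b), Vpay P E m' t b ≤ Vpay P E m t b) ∧
     (∀ a ∈ availA E m t, ∀ b ∈ availB E m t,
        ¬(P.u a b > Upay P E m t a ∧ P.v a b > Vpay P E m t b)))

/-- `Σ^Φ_T(E)`: the set of `Φ`-solutions of `E`. -/
def SolSet (P : Pref A B) (E : Economy A B) (φ : ConjFam A B) : Set (PreMatching A B) :=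
  {m | IsSolution P E φ m}

/-- The static (Gale–Shapley) notion of stability, for length-1 economies:
individual rationality plus absence of blocking pairs. -/
def Stable1 (P : Pref A B) (E : Economy A B) (m : PreMatching A B) : Prop :=
  IsMatching E m ∧
  (∀ a b, m.mA (E.T - 1) a = some b → 0 ≤ P.u a b) ∧
  (∀ b a, m.mB (E.T - 1) b = some a → 0 ≤ P.v a b) ∧
  (∀ a ∈ E.arrA 0, ∀ b ∈ E.arrB 0,
     ¬(P.u a b > Upay P E m 0 a ∧ P.v a b > Vpay P E m 0 b))

/-- The worst (minimal) period-`t` payoff of `a` over the set `C (inl a)` of matchings. -/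
def wA (P : Pref A B) (E : Economy A B) (t : ℕ)
    (C : Agent A B → Set (PreMatching A B)) (a : A) : ℝ :=
  sInf ((fun m' => Upay P E m' t a) '' C (Sum.inl a))

/-- The worst (minimal) period-`t` payoff of `b` over the set `C (inr b)` of matchings. -/
def wB (P : Pref A B) (E : Economy A B) (t : ℕ)
    (C : Agent A B → Set (PreMatching A B)) (b : B) : ℝ :=
  sInf ((fun m' => Vpay P E m' t b) '' C (Sum.inr b))

/-- Utility of side-`A` agent `a` in the induced one-period economy with outside
option value `W a` (truncated preferences). -/
def indU (P : Pref A B) (W : A → ℝ) (a : A) : Option B → ℝ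
  | none => W a
  | some b => P.u a b

/-- Utility of side-`B` agent `b` in the induced one-period economy with outside
option value `W b` (truncated preferences). -/
def indV (P : Pref A B) (W : B → ℝ) (b : B) : Option A → ℝ
  | none => W b
  | some a => P.v a b

/-- The period-`t` component of `mbar` is a stable matching of the one-period economy
`E_{t,φ}(m^{t-1})` induced by the conjecture profile `C` (Definition 6): matching among
the available agents, individually rational w.r.t. the worst-conjecture thresholds,
and without blocking pairs in the truncated preferences. -/
def StableInduced (P : Pref A B) (E : Economy A B) (m : PreMatching A B) (t : ℕ)
    (C : Agent A B → Set (PreMatching A B)) (mbar : PreMatching A B) : Prop :=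
  (∀ a ∈ availA E m t, ∀ b, mbar.mA t a = some b → b ∈ availB E m t ∧ mbar.mB t b = some a) ∧
  (∀ b ∈ availB E m t, ∀ a, mbar.mB t b = some a → a ∈ availA E m t ∧ mbar.mA t a = some b) ∧
  (∀ a ∈ availA E m t, ∀ b, mbar.mA t a = some b → wA P E t C a ≤ P.u a b) ∧
  (∀ b ∈ availB E m t, ∀ a, mbar.mB t b = some a → wB P E t C b ≤ P.v a b) ∧
  (∀ a ∈ availA E m t, ∀ b ∈ availB E m t,
     ¬(P.u a b > indU P (wA P E t C) a (mbar.mA t a) ∧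
       P.v a b > indV P (wB P E t C) b (mbar.mB t b)))

/-- `mbar_t` is stable among those who match in period `t` relative to the conjecture
profile `C` (Definition 7): every available agent matched in period `t` weakly prefers
its partner to its worst conjectured matching, and no pair of agents both matched in
period `t` blocks. -/
def StableAmongMatched (P : Pref A B) (E : Economy A B) (m : PreMatching A B) (t : ℕ)
    (C : Agent A B → Set (PreMatching A B)) (mbar : PreMatching A B) : Prop :=
  (∀ a ∈ availA E m t, ∀ b, mbar.mA t a = some b → wA P E t C a ≤ P.u a b) ∧
  (∀ b ∈ availB E m t, ∀ a, mbar.mB t b = some a → wB P E t C b ≤ P.v a b) ∧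
  (∀ a ∈ availA E m t, ∀ b ∈ availB E m t, ∀ b' a',
     mbar.mA t a = some b' → mbar.mB t b = some a' →
     ¬(P.u a b > P.u a b' ∧ P.v a b > P.v a' b))

/-- `E_t^T(m^{t-1})`: the continuation economy starting at period `t` given history `m`:
its first-period arrivals are the agents available at `t`, later arrivals are unchanged. -/
def contEconomy (E : Economy A B) (m : PreMatching A B) (t : ℕ) : Economy A B where
  T := E.T - t
  arrA := fun s => if s = 0 then availA E m t else E.arrA (t + s)
  arrB := fun s => if s = 0 then availB E m t else E.arrB (t + s)

/-- The restriction of `m` to the continuation economy starting in period `t`: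
time is shifted by `t` and agents matched strictly before `t` are dropped. -/
def restrictM (m : PreMatching A B) (t : ℕ) : PreMatching A B where
  mA := fun s a => if ∀ s', s' < t → m.mA s' a = none then m.mA (t + s) a else none
  mB := fun s b => if ∀ s', s' < t → m.mB s' b = none then m.mB (t + s) b else none

/-- The matching of the original economy corresponding to history `m` through period
`t-1` followed by the continuation matching `m'` (indexed from `0`) of the
continuation economy. -/
def splice (m m' : PreMatching A B) (t : ℕ) : PreMatching A B where
  mA := fun s a => if s < t then m.mA s a
    else if ∀ s', s' < t → m.mA s' a = none then m'.mA (s - t) a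
    else m.mA (t - 1) a
  mB := fun s b => if s < t then m.mB s b
    else if ∀ s', s' < t → m.mB s' b = none then m'.mB (s - t) b
    else m.mB (t - 1) b

/-- The family of conjectures that the family `φ` of the original economy induces on the
continuation economy `E_t^T(m^{t-1})`: at a continuation history, it is the (restriction
of the) original conjectures at the corresponding original history. -/
def contConj (E : Economy A B) (φ : ConjFam A B) (m : PreMatching A B) (t : ℕ) :
    ConjFam A B :=
  fun s mbar k => (fun m' => restrictM m' t) '' φ (t + s) (splice m mbar t) k

/-- The conjectures of eq. (2): the agent only rules out continuation matchings that do
not conform with the solution concept `S` from tomorrow onward. -/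
def starConj (S : Economy A B → Set (PreMatching A B)) (E : Economy A B) : ConjFam A B :=
  fun t m k =>
    {m' | m' ∈ MSet E m t k ∧ restrictM m' (t+1) ∈ S (contEconomy E m' (t+1))}

/-- `S` is the solution correspondence `Σ*` recursively generated by the conjectures of
eq. (2): stability for one-period economies, `Φ*`-solutions for longer economies
(empty continuations impose no restriction). -/
def IsStarFamily (P : Pref A B) (S : Economy A B → Set (PreMatching A B)) : Prop :=
  (∀ E : Economy A B, E.T = 0 → S E = Set.univ) ∧
  (∀ E : Economy A B, E.T = 1 → S E = {m | Stable1 P E m}) ∧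
  (∀ E : Economy A B, 2 ≤ E.T → S E = SolSet P E (starConj S E))

/-- The decreasing recursion defining the CVR conjectures at period `t`, history `m`,
relative to the continuation solution correspondence `DS`. -/
def cvrIter (P : Pref A B) (E : Economy A B)
    (DS : Economy A B → Set (PreMatching A B)) (t : ℕ) (m : PreMatching A B) :
    ℕ → Agent A B → Set (PreMatching A B)
  | 0 => fun k => MSet E m t k
  | n+1 => fun k =>
      {mbar | mbar ∈ MSet E m t k ∧
        StableAmongMatched P E m t (cvrIter P E DS t m n) mbar ∧
        restrictM mbar (t+1) ∈ DS (contEconomy E mbar (t+1))}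

/-- The CVR conjectures `φ_{D̂S,t}(m^{t-1},·)`: the limit (intersection) of the
decreasing recursion `cvrIter`. -/
def cvrConj (P : Pref A B) (DS : Economy A B → Set (PreMatching A B))
    (E : Economy A B) : ConjFam A B :=
  fun t m k => ⋂ n, cvrIter P E DS t m n k

/-- `DS` is the CVR-dynamic-stability correspondence `D̂S`: stable matchings for
one-period economies, `Φ_{D̂S}`-solutions for longer economies. -/
def IsCVRFamily (P : Pref A B) (DS : Economy A B → Set (PreMatching A B)) : Prop :=
  (∀ E : Economy A B, E.T = 0 → DS E = Set.univ) ∧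
  (∀ E : Economy A B, E.T = 1 → DS E = {m | Stable1 P E m}) ∧
  (∀ E : Economy A B, 2 ≤ E.T → DS E = SolSet P E (cvrConj P DS E))

/-- The dynamic-stability conjectures of Doval (2022): the period-`t` matching is stable
among those who match relative to individually rational continuation values, and the
continuation is dynamically stable. -/
def dsConj (P : Pref A B) (DSol : Economy A B → Set (PreMatching A B))
    (E : Economy A B) : ConjFam A B :=
  fun t m k =>
    {mbar | mbar ∈ MSet E m t k ∧
      (∀ a ∈ availA E m t, ∀ b, mbar.mA t a = some b → 0 ≤ P.u a b) ∧
      (∀ b ∈ availB E m t, ∀ a, mbar.mB t b = some a → 0 ≤ P.v a b) ∧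
      (∀ a ∈ availA E m t, ∀ b ∈ availB E m t, ∀ b' a',
         mbar.mA t a = some b' → mbar.mB t b = some a' →
         ¬(P.u a b > P.u a b' ∧ P.v a b > P.v a' b)) ∧
      restrictM mbar (t+1) ∈ DSol (contEconomy E mbar (t+1))}

/-- `DSol` is the dynamic-stability correspondence `DS` of Doval (2022). -/
def IsDSFamily (P : Pref A B) (DSol : Economy A B → Set (PreMatching A B)) : Prop :=
  (∀ E : Economy A B, E.T = 0 → DSol E = Set.univ) ∧
  (∀ E : Economy A B, E.T = 1 → DSol E = {m | Stable1 P E m}) ∧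
  (∀ E : Economy A B, 2 ≤ E.T → DSol E = SolSet P E (dsConj P DSol E))

/-- `E_{\k}`: the economy identical to `E` except that agent `k`'s arrival is delayed
by one period (from period `0` to period `1`). -/
def delayEconomy (E : Economy A B) : Agent A B → Economy A B
  | Sum.inl a =>
      { T := E.T
        arrA := fun s => if s = 0 then E.arrA 0 \ {a}
                 else if s = 1 then insert a (E.arrA 1) else E.arrA s
        arrB := E.arrB }
  | Sum.inr b =>
      { T := E.T
        arrA := E.arrA
        arrB := fun s => if s = 0 then E.arrB 0 \ {b}
                 else if s = 1 then insert b (E.arrB 1) else E.arrB s }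

/-- The candidate set `M*(m^{t-1}, C, Scont)`: matchings whose period-`t` matching is
stable in the one-period economy induced by the continuation-value sets `C`, and whose
continuation lies in `Scont` of the induced continuation economy. -/
def candT (P : Pref A B) (Scont : Economy A B → Set (PreMatching A B))
    (E : Economy A B) (t : ℕ) (m : PreMatching A B)
    (C : Agent A B → Set (PreMatching A B)) : Set (PreMatching A B) :=
  {mbar | mbar ∈ MSetH E m t ∧ StableInduced P E m t C mbar ∧
    restrictM mbar (t+1) ∈ Scont (contEconomy E mbar (t+1))}

/-- The increasing recursion `F_n` defining the sophisticated-dynamic-stability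
conjectures at period `t`, history `m`, relative to the correspondence `SDS` on
strictly shorter problems. -/
def sdsF (P : Pref A B) (SDS : Economy A B → Set (PreMatching A B))
    (E : Economy A B) (t : ℕ) (m : PreMatching A B) :
    ℕ → Agent A B → Set (PreMatching A B)
  | 0 => fun k =>
      {mbar | mbar ∈ MSet E m t k ∧
        restrictM mbar t ∈ SDS (delayEconomy (contEconomy E m t) k)}
  | n+1 => fun k => sdsF P SDS E t m n k ∪
      {mbar | mbar ∈ candT P SDS E t m (sdsF P SDS E t m n) ∧ unmatchedAt mbar t k}

/-- The SDS conjectures `φ_{SDS,t}`: the limit (union) of the increasing recursion `F_n`. -/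
def sdsConj (P : Pref A B) (SDS : Economy A B → Set (PreMatching A B))
    (E : Economy A B) : ConjFam A B :=
  fun t m k => ⋃ n, sdsF P SDS E t m n k

/-- `SDS` is the sophisticated-dynamic-stability correspondence. -/
def IsSDSFamily (P : Pref A B) (SDS : Economy A B → Set (PreMatching A B)) : Prop :=
  (∀ E : Economy A B, E.T = 0 → SDS E = Set.univ) ∧
  (∀ E : Economy A B, E.T = 1 → SDS E = {m | Stable1 P E m}) ∧
  (∀ E : Economy A B, 2 ≤ E.T → SDS E = SolSet P E (sdsConj P SDS E))

/-- The rational-expectations conjectures: `k` conjectures exactly the `RE` solutions of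
the continuation economy in which `k`'s arrival is delayed by one period. -/
def reConj (RE : Economy A B → Set (PreMatching A B)) (E : Economy A B) : ConjFam A B :=
  fun t m k =>
    {mbar | mbar ∈ MSet E m t k ∧
      restrictM mbar t ∈ RE (delayEconomy (contEconomy E m t) k)}

/-- `RE` is the rational-expectations solution correspondence. -/
def IsREFamily (P : Pref A B) (RE : Economy A B → Set (PreMatching A B)) : Prop :=
  (∀ E : Economy A B, E.T = 1 → RE E = {m | Stable1 P E m}) ∧
  (∀ E : Economy A B, 2 ≤ E.T → RE E = SolSet P E (reConj RE E))


theorem arrAUpTo_contEconomy_subset (E : Economy A B) (m : PreMatching A B) (t s : ℕ) :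
    arrAUpTo (contEconomy E m t) s ⊆ arrAUpTo E (t + s) := by
  intro a ha
  simp only [arrAUpTo, Finset.mem_biUnion, Finset.mem_range, contEconomy] at ha ⊢
  obtain ⟨i, hi, hai⟩ := ha
  split_ifs at hai
  · simp only [availA, arrAUpTo, Finset.mem_filter, Finset.mem_biUnion, Finset.mem_range] at hai
    obtain ⟨⟨j, hj, haj⟩, -⟩ := hai
    exact ⟨j, by omega, haj⟩
  · exact ⟨t + i, by omega, hai⟩

theorem arrBUpTo_contEconomy_subset (E : Economy A B) (m : PreMatching A B) (t s : ℕ) :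
    arrBUpTo (contEconomy E m t) s ⊆ arrBUpTo E (t + s) := by
  intro b hb
  simp only [arrBUpTo, Finset.mem_biUnion, Finset.mem_range, contEconomy] at hb ⊢
  obtain ⟨i, hi, hbi⟩ := hb
  split_ifs at hbi
  · simp only [availB, arrBUpTo, Finset.mem_filter, Finset.mem_biUnion, Finset.mem_range] at hbi
    obtain ⟨⟨j, hj, hbj⟩, -⟩ := hbi
    exact ⟨j, by omega, hbj⟩
  · exact ⟨t + i, by omega, hbi⟩

theorem availA_disjoint_arrA {E : Economy A B} (hE : E.Valid) (m : PreMatching A B)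
    {t s : ℕ} (hts : t < s) : Disjoint (availA E m t) (E.arrA s) := by
  refine Finset.disjoint_left.2 fun a ha has => ?_
  simp only [availA, arrAUpTo, Finset.mem_filter, Finset.mem_biUnion, Finset.mem_range] at ha
  obtain ⟨⟨j, hj, haj⟩, -⟩ := ha
  exact Finset.disjoint_left.1 (hE.2.1 j s (by omega)) haj has

theorem availB_disjoint_arrB {E : Economy A B} (hE : E.Valid) (m : PreMatching A B)
    {t s : ℕ} (hts : t < s) : Disjoint (availB E m t) (E.arrB s) := by
  refine Finset.disjoint_left.2 fun b hb hbs => ?_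
  simp only [availB, arrBUpTo, Finset.mem_filter, Finset.mem_biUnion, Finset.mem_range] at hb
  obtain ⟨⟨j, hj, hbj⟩, -⟩ := hb
  exact Finset.disjoint_left.1 (hE.2.2.1 j s (by omega)) hbj hbs

theorem Economy.Valid.contEconomy {E : Economy A B} (hE : E.Valid) (m : PreMatching A B)
    {t : ℕ} (ht : t < E.T) : (contEconomy E m t).Valid := by
  refine ⟨Nat.sub_pos_of_lt ht, fun r s hrs => ?_, fun r s hrs => ?_, fun s hs => ?_,
    fun s hs => ?_⟩
  · simp only [DynMatch.contEconomy]
    split_ifs with hr hs hs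
    · omega
    · exact availA_disjoint_arrA hE m (by omega)
    · exact (availA_disjoint_arrA hE m (by omega)).symm
    · exact hE.2.1 _ _ (by omega)
  · simp only [DynMatch.contEconomy]
    split_ifs with hr hs hs
    · omega
    · exact availB_disjoint_arrB hE m (by omega)
    · exact (availB_disjoint_arrB hE m (by omega)).symm
    · exact hE.2.2.1 _ _ (by omega)
  · simp only [DynMatch.contEconomy] at hs ⊢
    rw [if_neg (by omega)]
    exact hE.2.2.2.1 _ (by omega)
  · simp only [DynMatch.contEconomy] at hs ⊢
    rw [if_neg (by omega)]
    exact hE.2.2.2.2 _ (by omega)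

/-- A CVR-dynamically stable matching of an economy of positive length is a matching. -/
theorem IsCVRFamily.isMatching {P : Pref A B} {DS : Economy A B → Set (PreMatching A B)}
    (hDS : IsCVRFamily P DS) {E : Economy A B} (hT : 0 < E.T) {m : PreMatching A B}
    (hm : m ∈ DS E) : IsMatching E m := by
  obtain h | h : E.T = 1 ∨ 2 ≤ E.T := by omega
  · rw [hDS.2.1 E h] at hm
    exact hm.1
  · rw [hDS.2.2 E h] at hm
    exact hm.1

/-- Delaying a matching of the continuation economy after an initial period in which nobody
matches gives a matching of the original economy. -/
theorem IsMatching.splice_emptyM {E : Economy A B} {m : PreMatching A B}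
    (hm : IsMatching (contEconomy E emptyM 1) m) : IsMatching E (splice emptyM m 1) := by
  obtain ⟨hinv, hA, hB, hirrA, hirrB⟩ := hm
  have hT : (contEconomy E emptyM 1).T = E.T - 1 := rfl
  rw [hT] at hinv hA hB hirrA hirrB
  refine ⟨fun t a b ht => ?_, fun t a ht h => ?_, fun t a b ht h => ?_,
    fun t s a hts hs h => ?_, fun t s b hts hs h => ?_⟩
  · cases t with
    | zero => simp [splice, emptyM]
    | succ t => simpa [splice, emptyM] using hinv t a b (by omega)
  · cases t with
    | zero => simp [splice, emptyM] at h
    | succ t =>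
      have := arrAUpTo_contEconomy_subset E emptyM 1 t
        (hA t a (by omega) (by simpa [splice, emptyM] using h))
      rwa [Nat.add_comm] at this
  · cases t with
    | zero => simp [splice, emptyM] at h
    | succ t =>
      have := arrBUpTo_contEconomy_subset E emptyM 1 t
        (hB t a b (by omega) (by simpa [splice, emptyM] using h))
      rwa [Nat.add_comm] at this
  · cases t with
    | zero => simp [splice, emptyM] at h
    | succ t =>
      obtain ⟨s, rfl⟩ : ∃ r, s = r + 1 := ⟨s - 1, by omega⟩
      simpa [splice, emptyM] using
        hirrA t s a (by omega) (by omega) (by simpa [splice, emptyM] using h)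
  · cases t with
    | zero => simp [splice, emptyM] at h
    | succ t =>
      obtain ⟨s, rfl⟩ : ∃ r, s = r + 1 := ⟨s - 1, by omega⟩
      simpa [splice, emptyM] using
        hirrB t s b (by omega) (by omega) (by simpa [splice, emptyM] using h)

theorem restrictM_splice_emptyM (m : PreMatching A B) :
    restrictM (splice emptyM m 1) 1 = m := by
  simp [restrictM, splice, emptyM]

theorem contEconomy_splice_emptyM (E : Economy A B) (m : PreMatching A B) :
    contEconomy E (splice emptyM m 1) 1 = contEconomy E emptyM 1 := by
  simp [contEconomy, availA, availB, splice, emptyM]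

/-- A matching in which nobody matches in the first period survives every step of the CVR
recursion as soon as its continuation is a solution. -/
theorem mem_cvrIter_of_unmatched (P : Pref A B) (DS : Economy A B → Set (PreMatching A B))
    {E : Economy A B} {k : Agent A B} {m : PreMatching A B} (hm : m ∈ MSet E emptyM 0 k)
    (hA : ∀ a, m.mA 0 a = none) (hB : ∀ b, m.mB 0 b = none)
    (hcont : restrictM m 1 ∈ DS (contEconomy E m 1)) (n : ℕ) :
    m ∈ cvrIter P E DS 0 emptyM n k := by
  cases n with
  | zero => exact hm
  | succ n => exact ⟨hm, ⟨by simp [hA], by simp [hB], by simp [hA]⟩, hcont⟩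

/-- every stage `φ_n` of the decreasing CVR recursion contains every
matching in which no agent matches in period 1 and whose continuation is
CVR-dynamically stable; consequently the limit conjectures `φ_∞(∅,k) = φ_{D̂S,1}(∅,k)`
are nonempty for every period-1 agent `k`. -/
theorem statement8
    (A B : Type) [DecidableEq A] [DecidableEq B]
    (P : Pref A B) (hP : P.Valid)
    (DS : Economy A B → Set (PreMatching A B)) (hDS : IsCVRFamily P DS)
    (E : Economy A B) (hE : E.Valid) (hT : 2 ≤ E.T)
    (hne : ∀ E' : Economy A B, E'.Valid → E'.T + 1 = E.T → (DS E').Nonempty) :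
    (∀ n : ℕ, ∀ k : Agent A B, inPeriodOne E k →
      ∀ mbar ∈ MSet E emptyM 0 k,
        (∀ a : A, mbar.mA 0 a = none) → (∀ b : B, mbar.mB 0 b = none) →
        restrictM mbar 1 ∈ DS (contEconomy E mbar 1) →
        mbar ∈ cvrIter P E DS 0 emptyM n k) ∧
    (∀ k : Agent A B, inPeriodOne E k →
      (⋂ n, cvrIter P E DS 0 emptyM n k).Nonempty) := by
  refine ⟨fun n k _ m hm hA hB hcont => mem_cvrIter_of_unmatched P DS hm hA hB hcont n,
    fun k _ => ?_⟩
  have hvalid : (contEconomy E emptyM 1).Valid := hE.contEconomy emptyM hT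
  obtain ⟨m, hm⟩ := hne (contEconomy E emptyM 1) hvalid (Nat.sub_add_cancel hE.1)
  refine ⟨splice emptyM m 1, Set.mem_iInter.2 <| mem_cvrIter_of_unmatched P DS
    ⟨(hDS.isMatching hvalid.1 hm).splice_emptyM, fun s hs => absurd hs s.not_lt_zero, ?_⟩
    (by simp [splice, emptyM]) (by simp [splice, emptyM]) ?_⟩
  · cases k <;> simp [unmatchedThrough, splice, emptyM]
  · rwa [restrictM_splice_emptyM, contEconomy_splice_emptyM]

end

end DynMatch
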